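/- For every nonempty string w, ρ(BWT(w)) ≤ 2 · ρ(w). -/

import Mathlib

/-! Basic definitions: strings as `List α`, rotations, runs, BWT, Lyndon
factorization, ω-order, bijective BWT, and Fibonacci words. -/

variable {α : Type*}

/-- Left cyclic rotation by one symbol. -/
def rot (x : List α) : List α := x.drop 1 ++ x.take 1

/-- The list of all `|x|` cyclic rotations of `x`. -/
def rotations (x : List α) : List (List α) :=
  (List.range x.length).map (fun i => rot^[i] x)

/-- ρ: the number of maximal runs of equal consecutive symbols. -/
def runsCount [DecidableEq α] : List α → ℕ
  | [] => 0
  | [_] => 1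
  | a :: b :: t => (if a = b then 0 else 1) + runsCount (b :: t)

/-- The Burrows–Wheeler transform: last symbols of the lexicographically
sorted rotations. -/
def BWT [LinearOrder α] (w : List α) : List α :=
  (List.insertionSort (· ≤ ·) (rotations w)).filterMap List.getLast?

/-- The lexicographically smallest rotation of `x`. -/
def lexMinRotation [LinearOrder α] (x : List α) : List α :=
  (List.insertionSort (· ≤ ·) (rotations x)).headD x

/-- A Lyndon word: nonempty and strictly smaller than all its proper rotations. -/
def IsLyndon [LinearOrder α] (x : List α) : Prop :=
  x ≠ [] ∧ ∀ i < x.length, 0 < i → x < rot^[i] x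

instance [LinearOrder α] : DecidablePred (IsLyndon (α := α)) := fun _ =>
  inferInstanceAs (Decidable (_ ∧ _))

/-- The longest prefix of `w` that is a Lyndon word (the first Lyndon factor). -/
def firstLyndonFactor [LinearOrder α] (w : List α) : List α :=
  (((List.range (w.length + 1)).map (fun i => w.take i)).filter
    (fun x => decide (IsLyndon x))).getLastD []

def lyndonFactAux [LinearOrder α] : ℕ → List α → List (List α)
  | 0, _ => []
  | _, [] => []
  | fuel+1, w =>
      let p := firstLyndonFactor w
      if p.isEmpty then [] else p :: lyndonFactAux fuel (w.drop p.length)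

/-- The Lyndon factorization of `w`: repeatedly peel off the longest Lyndon
prefix (equivalently, the unique nonincreasing factorization into Lyndon words). -/
def lyndonFactorization [LinearOrder α] (w : List α) : List (List α) :=
  lyndonFactAux w.length w

/-- `listPow x n = x^n`. -/
def listPow (x : List α) : ℕ → List α
  | 0 => []
  | n+1 => x ++ listPow x n

/-- ω-order: `x ≤ω y` iff `x^∞ ≤ y^∞` lexicographically; comparing the
equal-length words `x^{|y|}` and `y^{|x|}` is equivalent. -/
def omegaLE [LinearOrder α] (x y : List α) : Prop :=
  listPow x y.length ≤ listPow y x.length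

instance [LinearOrder α] : DecidableRel (omegaLE (α := α)) := fun _ _ =>
  inferInstanceAs (Decidable (_ ≤ _))

/-- The bijective Burrows–Wheeler transform: last symbols of all rotations of
all Lyndon factors of `w`, sorted in ω-order. -/
def BBWT [LinearOrder α] (w : List α) : List α :=
  (List.insertionSort omegaLE
    (((lyndonFactorization w).map rotations).flatten)).filterMap List.getLast?

/-- Fibonacci words over symbols `a < b`: `F 0 = b`, `F 1 = a`,
`F (i+2) = F (i+1) ++ F i`. -/
def fibWordG (a b : α) : ℕ → List α
  | 0 => [b]
  | 1 => [a]
  | n+2 => fibWordG a b (n+1) ++ fibWordG a b n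

/-- Fibonacci words over `Fin 2` with `a = 0 < b = 1`. -/
def fibWord : ℕ → List (Fin 2) := fibWordG 0 1

open List in
/-- Appending `c` to a word below `c^ω` gives something smaller than prepending it. -/
theorem append_singleton_lt_cons [LinearOrder α] (c : α) (u : List α)
    (h : u ++ [c] < replicate (u.length + 1) c) :
    u ++ [c] < c :: u ∧ u < replicate u.length c := by
  induction u with
  | nil => simp at h
  | cons d u ih =>
    rw [length_cons, replicate_succ, cons_append, cons_lt_cons_iff] at h
    rw [length_cons, replicate_succ, cons_append, cons_lt_cons_iff, cons_lt_cons_iff]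
    rcases h with h | ⟨rfl, h⟩
    · exact ⟨.inl h, .inl h⟩
    · exact ⟨.inr ⟨rfl, (ih h).1⟩, .inr ⟨rfl, (ih h).2⟩⟩

open List in
/-- Appending `c` to a word above `c^ω` gives something larger than prepending it. -/
theorem cons_lt_append_singleton [LinearOrder α] (c : α) (u : List α)
    (h : replicate (u.length + 1) c < u ++ [c]) :
    c :: u < u ++ [c] ∧ replicate u.length c < u := by
  induction u with
  | nil => simp at h
  | cons d u ih =>
    rw [length_cons, replicate_succ, cons_append, cons_lt_cons_iff] at h
    rw [length_cons, replicate_succ, cons_append, cons_lt_cons_iff, cons_lt_cons_iff]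
    rcases h with h | ⟨rfl, h⟩
    · exact ⟨.inl h, .inl h⟩
    · exact ⟨.inr ⟨rfl, (ih h).1⟩, .inr ⟨rfl, (ih h).2⟩⟩

theorem headD_mono [LinearOrder α] (d : α) {x y : List α} (hx : x ≠ []) (hxy : x ≤ y) :
    x.headD d ≤ y.headD d := by
  match x, y with
  | [], _ => exact absurd rfl hx
  | a :: x, [] => exact absurd hxy (not_le.2 (List.nil_lt_cons a x))
  | a :: x, b :: y =>
    by_contra! h
    exact absurd hxy (not_le.2 (List.cons_lt_cons_iff.2 (.inl h)))

theorem rot_eq_rotate (x : List α) : rot x = x.rotate 1 := by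
  cases x <;> simp [rot]

theorem rot_iterate (x : List α) (i : ℕ) : rot^[i] x = x.rotate i := by
  induction i with
  | zero => simp
  | succ i ih => rw [Function.iterate_succ_apply', ih, rot_eq_rotate, List.rotate_rotate]

theorem mem_rotations_iff {w : List α} (hw : w ≠ []) {x : List α} :
    x ∈ rotations w ↔ w ~r x := by
  have : 0 < w.length := List.length_pos_iff.2 hw
  simp only [rotations, rot_iterate, List.mem_map, List.mem_range, List.isRotated_iff_mod]
  constructor
  · rintro ⟨i, hi, rfl⟩
    exact ⟨i, hi.le, rfl⟩
  · rintro ⟨i, hi, rfl⟩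
    exact ⟨i % w.length, Nat.mod_lt _ this, List.rotate_mod w i⟩

theorem runsCount_le_one [DecidableEq α] {c : α} (l : List α) (h : ∀ x ∈ l, x = c) :
    runsCount l ≤ 1 := by
  induction l with
  | nil => simp [runsCount]
  | cons a t ih =>
    cases t with
    | nil => simp [runsCount]
    | cons b t =>
      have ha := h a (by simp)
      have hb := h b (by simp)
      have := ih fun x hx => h x (List.mem_cons_of_mem _ hx)
      simp only [runsCount]
      simp [ha, hb] at this ⊢
      exact this

theorem one_le_runsCount [DecidableEq α] {l : List α} (h : l ≠ []) : 1 ≤ runsCount l := by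
  induction l with
  | nil => exact absurd rfl h
  | cons a t ih =>
    cases t with
    | nil => simp [runsCount]
    | cons b t =>
      have := ih (by simp)
      simp only [runsCount]
      omega

theorem runsCount_cons_eq [DecidableEq α] (a : α) (t : List α) :
    runsCount (a :: t) =
      (List.range t.length).countP (fun i => (a :: t)[i]? ≠ (a :: t)[i + 1]?) + 1 := by
  induction t generalizing a with
  | nil => simp [runsCount]
  | cons b t ih =>
    rw [runsCount, ih b, List.length_cons, List.range_succ_eq_map, List.countP_cons,
      List.countP_map]
    simp only [Function.comp_def, List.getElem?_cons_succ, List.getElem?_cons_zero]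
    by_cases h : a = b
    · simp [h]
    · simp [h]
      omega

/-- The number of rotations whose first and last symbols differ is at most the number of runs. -/
theorem countP_rotations_le [DecidableEq α] (d : α) (w : List α) :
    (rotations w).countP (fun x => x.headD d ≠ x.getLastD d) ≤ runsCount w := by
  cases w with
  | nil => simp [rotations]
  | cons a t =>
    rw [runsCount_cons_eq, rotations, List.countP_map, List.length_cons,
      List.range_succ_eq_map, List.countP_cons, List.countP_map]
    refine add_le_add (le_of_eq ?_) (by split <;> simp)
    refine List.countP_congr fun i hi => ?_
    rw [List.mem_range] at hi
    have hi0 : i < (a :: t).length := by simp; omega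
    have hi1 : i + 1 < (a :: t).length := by simpa using hi
    have h1 : ((a :: t).rotate (i + 1)).headD d = (a :: t)[i + 1] := by
      rw [List.headD_eq_head?_getD, List.head?_rotate hi1, List.getElem?_eq_getElem hi1,
        Option.getD_some]
    have h2 : ((a :: t).rotate (i + 1)).getLastD d = (a :: t)[i] := by
      rw [List.rotate_eq_drop_append_take hi1.le, List.getLastD_eq_getLast?,
        List.getLast?_append, List.getLast?_take]
      simp [List.getElem?_eq_getElem hi0]
    rw [Function.comp_apply, Function.comp_apply, rot_iterate, Nat.succ_eq_add_one, h1, h2,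
      List.getElem?_eq_getElem hi0, List.getElem?_eq_getElem hi1]
    simp only [ne_eq, Option.some.injEq, decide_eq_true_eq]
    rw [eq_comm]

/-- Abstract counting: if every `low` element with `F = L` is followed by a `low` element with the
same `F`, and every other element with `F = L` is preceded by a non-`low` element with the same
`F`, then the number of runs of `L` is controlled by the number of elements with `F ≠ L`. -/
theorem runsCount_map_le {β γ : Type*} [DecidableEq γ] (F L : β → γ) (low : β → Prop)
    [DecidablePred low] (a : β) (t : List β)
    (hchain : (a :: t).IsChain fun x y =>
      (low x → F x = L x → low y ∧ F x = F y) ∧ (¬ low y → F y = L y → ¬ low x ∧ F x = F y))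
    (hlast : ∀ x ∈ (a :: t).getLast?, low x → F x ≠ L x) :
    runsCount ((a :: t).map L) + (if low a ∧ F a ≠ L a then 1 else 0) ≤
      2 * (a :: t).countP (fun x => F x ≠ L x) + (if ¬ low a ∧ F a = L a then 1 else 0) := by
  induction t generalizing a with
  | nil =>
    simp only [List.getLast?_singleton, Option.mem_def, Option.some.injEq, forall_eq'] at hlast
    by_cases hl : low a <;> by_cases hm : F a = L a <;> simp_all [runsCount]
  | cons b t ih =>
    rw [List.isChain_cons_cons] at hchain
    obtain ⟨⟨h1, h2⟩, hchain⟩ := hchain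
    have := ih b hchain (by simpa using hlast)
    rw [List.countP_cons, List.map_cons, List.map_cons, runsCount]
    rw [List.map_cons] at this
    by_cases hl : low a <;> by_cases hm : F a = L a <;> by_cases hl' : low b <;>
      by_cases hm' : F b = L b <;> by_cases he : L a = L b <;>
      simp [hl, hm, hl', hm', he] at h1 h2 this ⊢ <;> first | omega | simp_all

/-- In a sorted list, consecutive elements `x, y` satisfy `y ≤ z` for any later member `z > x`,
and `z ≤ x` for any earlier member `z < y`. -/
theorem isChain_of_sorted {β : Type*} [LinearOrder β] (l : List β) (h : l.Pairwise (· ≤ ·)) :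
    l.IsChain fun x y => x ∈ l ∧ y ∈ l ∧ x ≤ y ∧
      (∀ z ∈ l, x < z → y ≤ z) ∧ (∀ z ∈ l, z < y → z ≤ x) := by
  rw [List.isChain_iff_getElem]
  have hm : ∀ i j (hi : i < l.length) (hj : j < l.length), i ≤ j → l[i] ≤ l[j] :=
    fun i j hi hj hij => h.sortedLE.monotone_get (a := ⟨i, hi⟩) (b := ⟨j, hj⟩) hij
  intro i hi
  refine ⟨List.getElem_mem _, List.getElem_mem _, hm _ _ _ _ (by omega), ?_, ?_⟩
  · intro z hz hlt
    obtain ⟨j, hj, rfl⟩ := List.mem_iff_getElem.1 hz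
    refine hm _ _ _ _ ?_
    by_contra! hc
    exact absurd hlt (not_lt.2 (hm _ _ _ _ (by omega)))
  · intro z hz hlt
    obtain ⟨j, hj, rfl⟩ := List.mem_iff_getElem.1 hz
    refine hm _ _ _ _ ?_
    by_contra! hc
    exact absurd hlt (not_lt.2 (hm _ _ _ _ (by omega)))

theorem filterMap_getLast?_eq_map (d : α) (S : List (List α)) (h : ∀ x ∈ S, x ≠ []) :
    S.filterMap List.getLast? = S.map (fun x => x.getLastD d) := by
  induction S with
  | nil => rfl
  | cons x S ih =>
    have hx := h x (by simp)
    rw [List.filterMap_cons_some (List.getLast?_eq_some_getLast hx),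
      ih fun y hy => h y (List.mem_cons_of_mem _ hy)]
    simp [List.getLastD_eq_getLast?, List.getLast?_eq_some_getLast hx]

/-- The word is smaller than the power of its first symbol of the same length. -/
def IsLow [LinearOrder α] (d : α) (x : List α) : Prop :=
  x < List.replicate x.length (x.headD d)

theorem exists_gt_of_isLow [LinearOrder α] {d : α} {x : List α} (hx : x ≠ [])
    (hl : IsLow d x) (hm : x.headD d = x.getLastD d) :
    ∃ y, x ~r y ∧ x < y ∧ IsLow d y ∧ x.headD d = y.headD d := by
  obtain ⟨u, c, rfl⟩ := (List.eq_nil_or_concat x).resolve_left hx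
  rw [List.concat_eq_append] at *
  have hc : (u ++ [c]).headD d = c := by rw [hm]; simp
  rw [IsLow, hc, List.length_append, List.length_singleton] at hl
  obtain ⟨h1, h2⟩ := append_singleton_lt_cons c u hl
  refine ⟨c :: u, List.isRotated_append, h1, ?_, by rw [hc]; rfl⟩
  rw [IsLow, List.length_cons, List.replicate_succ, List.headD_cons, List.cons_lt_cons_iff]
  exact .inr ⟨rfl, h2⟩

theorem exists_lt_of_not_isLow [LinearOrder α] {d : α} {x : List α} (hx : x ≠ [])
    (hl : ¬ IsLow d x) (hne : x ≠ List.replicate x.length (x.headD d))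
    (hm : x.headD d = x.getLastD d) :
    ∃ y, x ~r y ∧ y < x ∧ ¬ IsLow d y ∧ x.headD d = y.headD d := by
  obtain ⟨u, c, rfl⟩ := (List.eq_nil_or_concat x).resolve_left hx
  rw [List.concat_eq_append] at *
  have hc : (u ++ [c]).headD d = c := by rw [hm]; simp
  rw [IsLow, hc, List.length_append, List.length_singleton, not_lt] at hl
  rw [hc, List.length_append, List.length_singleton] at hne
  obtain ⟨h1, h2⟩ := cons_lt_append_singleton c u (lt_of_le_of_ne hl hne.symm)
  refine ⟨c :: u, List.isRotated_append, h1, ?_, by rw [hc]; rfl⟩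
  rw [IsLow, List.length_cons, List.replicate_succ, List.headD_cons, not_lt]
  exact (List.cons_lt_cons_iff.2 (.inr ⟨rfl, h2⟩)).le

/-- for every nonempty string `w`, `ρ(BWT(w)) ≤ 2·ρ(w)`. -/
theorem stmt11 [LinearOrder α] (w : List α) (hw : w ≠ []) :
    runsCount (BWT w) ≤ 2 * runsCount w := by
  classical
  set d : α := w.head hw
  set S := List.insertionSort (· ≤ ·) (rotations w)
  have hperm : S.Perm (rotations w) := List.perm_insertionSort _ _
  have hmem : ∀ x, x ∈ S ↔ w ~r x := fun x => by rw [hperm.mem_iff, mem_rotations_iff hw]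
  have hlen : ∀ x ∈ S, x.length = w.length := fun x hx => ((hmem x).1 hx).perm.length_eq.symm
  have hnil : ∀ x ∈ S, x ≠ [] := by
    rintro x hx rfl
    exact hw (List.length_eq_zero_iff.1 (hlen _ hx).symm)
  have hB : BWT w = S.map (fun x => x.getLastD d) := filterMap_getLast?_eq_map d S hnil
  by_cases hu : ∃ c, ∀ a ∈ w, a = c
  · obtain ⟨c, hc⟩ := hu
    have h1 : runsCount (BWT w) ≤ 1 := by
      refine runsCount_le_one (c := c) _ fun a ha => ?_
      rw [BWT, List.mem_filterMap] at ha
      obtain ⟨x, hx, hxa⟩ := ha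
      exact hc a (((hmem x).1 hx).perm.mem_iff.2 (List.mem_of_getLast? hxa))
    have := one_le_runsCount hw
    omega
  have hne : ∀ x ∈ S, x ≠ List.replicate x.length (x.headD d) := by
    intro x hx he
    refine hu ⟨x.headD d, fun a ha => ?_⟩
    have : a ∈ x := ((hmem x).1 hx).perm.mem_iff.1 ha
    rw [he] at this
    exact List.eq_of_mem_replicate this
  have hlow : ∀ x ∈ S, IsLow d x → x.headD d = x.getLastD d →
      ∃ y ∈ S, x < y ∧ IsLow d y ∧ x.headD d = y.headD d := by
    intro x hx hl hm
    obtain ⟨y, hr, h⟩ := exists_gt_of_isLow (hnil x hx) hl hm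
    exact ⟨y, (hmem y).2 (((hmem x).1 hx).trans hr), h⟩
  have hhigh : ∀ x ∈ S, ¬ IsLow d x → x.headD d = x.getLastD d →
      ∃ y ∈ S, y < x ∧ ¬ IsLow d y ∧ x.headD d = y.headD d := by
    intro x hx hl hm
    obtain ⟨y, hr, h⟩ := exists_lt_of_not_isLow (hnil x hx) hl (hne x hx) hm
    exact ⟨y, (hmem y).2 (((hmem x).1 hx).trans hr), h⟩
  have hsorted : S.Pairwise (· ≤ ·) := List.pairwise_insertionSort _ _
  have hchain : S.IsChain fun x y =>
      (IsLow d x → x.headD d = x.getLastD d → IsLow d y ∧ x.headD d = y.headD d) ∧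
      (¬ IsLow d y → y.headD d = y.getLastD d → ¬ IsLow d x ∧ x.headD d = y.headD d) := by
    refine (isChain_of_sorted S hsorted).imp fun x y ⟨hx, hy, hxy, h1, h2⟩ => ⟨?_, ?_⟩
    · intro hl hm
      obtain ⟨z, hz, hxz, hlz, he⟩ := hlow x hx hl hm
      have hyz := h1 z hz hxz
      have e1 := headD_mono d (hnil x hx) hxy
      have e2 := headD_mono d (hnil y hy) hyz
      have e : x.headD d = y.headD d := le_antisymm e1 (he ▸ e2)
      refine ⟨?_, e⟩
      rw [IsLow, hlen z hz, ← he, e] at hlz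
      rw [IsLow, hlen y hy]
      exact hyz.trans_lt hlz
    · intro hl hm
      obtain ⟨z, hz, hzy, hlz, he⟩ := hhigh y hy hl hm
      have hzx := h2 z hz hzy
      have e1 := headD_mono d (hnil x hx) hxy
      have e2 := headD_mono d (hnil z hz) hzx
      have e : x.headD d = y.headD d := le_antisymm e1 (he ▸ e2)
      refine ⟨?_, e⟩
      rw [IsLow, hlen z hz, ← he, ← e, not_lt] at hlz
      rw [IsLow, hlen x hx, not_lt]
      exact hlz.trans hzx
  have hlast : ∀ x ∈ S.getLast?, IsLow d x → x.headD d ≠ x.getLastD d := by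
    intro x hx hl hm
    have hxS := List.mem_of_getLast? hx
    obtain ⟨y, hy, hxy, -⟩ := hlow x hxS hl hm
    obtain ⟨l, hl⟩ := List.getLast?_eq_some_iff.1 hx
    rw [hl] at hsorted hy
    rcases List.mem_append.1 hy with h | h
    · exact absurd hxy (not_lt.2 ((List.pairwise_append.1 hsorted).2.2 y h x (by simp)))
    · exact absurd hxy (by simp_all)
  have hcount : S.countP (fun x => x.headD d ≠ x.getLastD d) ≤ runsCount w := by
    rw [hperm.countP_eq]
    exact countP_rotations_le d w
  rw [hB]
  clear_value S
  cases S with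
  | nil => simp [runsCount]
  | cons a t =>
    have key := runsCount_map_le _ _ _ a t hchain hlast
    have ha : ¬ (¬ IsLow d a ∧ a.headD d = a.getLastD d) := by
      rintro ⟨hl, hm⟩
      obtain ⟨y, hy, hya, -⟩ := hhigh a (by simp) hl hm
      rcases List.mem_cons.1 hy with rfl | h
      · exact lt_irrefl _ hya
      · exact absurd hya (not_lt.2 (List.rel_of_pairwise_cons hsorted h))
    rw [if_neg ha] at key
    omega
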